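/- arXiv:math/0110014 — 4 statements merged into one kernel-verified Lean document; each statement's English description precedes it below -/
import Mathlib

section
/- The set of pairs (n, σ) with n a natural number and σ ∈ S_n, equipped with the multiplication (n, σ) ∘ (m, τ) := (nm, Φ(σ, τ)) and unit (1, id), is a monoid; that is, this multiplication is associative and (1, id₁) is a two-sided identity. -/
theorem fin_val_mod_lt {n m : ℕ} (x : Fin (n * m)) : (x : ℕ) % n < n := by
  rcases Nat.eq_zero_or_pos n with h | h
  · exact absurd x.isLt (by simp [h])
  · exact Nat.mod_lt _ h

theorem fin_val_div_lt {n m : ℕ} (x : Fin (n * m)) : (x : ℕ) / n < m :=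
  Nat.div_lt_of_lt_mul x.isLt

def PhiFun {n m : ℕ} (σ : Equiv.Perm (Fin n)) (τ : Equiv.Perm (Fin m))
    (x : Fin (n * m)) : Fin (n * m) :=
  ⟨m * (σ ⟨(x : ℕ) % n, fin_val_mod_lt x⟩ : ℕ) + (τ ⟨(x : ℕ) / n, fin_val_div_lt x⟩ : ℕ), by
    have h1 : ((σ ⟨(x : ℕ) % n, fin_val_mod_lt x⟩ : Fin n) : ℕ) + 1 ≤ n :=
      (σ _).isLt
    have h2 : ((τ ⟨(x : ℕ) / n, fin_val_div_lt x⟩ : Fin m) : ℕ) < m := (τ _).isLt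
    have h3 : m * ((σ ⟨(x : ℕ) % n, fin_val_mod_lt x⟩ : Fin n) : ℕ) +
        ((τ ⟨(x : ℕ) / n, fin_val_div_lt x⟩ : Fin m) : ℕ) <
        m * (((σ ⟨(x : ℕ) % n, fin_val_mod_lt x⟩ : Fin n) : ℕ) + 1) := by
      rw [Nat.mul_succ]; exact Nat.add_lt_add_left h2 _
    exact h3.trans_le ((Nat.mul_le_mul_left m h1).trans_eq (Nat.mul_comm m n))⟩

theorem phiFun_bijective {n m : ℕ} (σ : Equiv.Perm (Fin n)) (τ : Equiv.Perm (Fin m)) :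
    Function.Bijective (PhiFun σ τ) := by
  rw [← Finite.injective_iff_bijective]
  intro x y h
  have h' : m * (σ ⟨(x : ℕ) % n, fin_val_mod_lt x⟩ : ℕ) + (τ ⟨(x : ℕ) / n, fin_val_div_lt x⟩ : ℕ)
      = m * (σ ⟨(y : ℕ) % n, fin_val_mod_lt y⟩ : ℕ) + (τ ⟨(y : ℕ) / n, fin_val_div_lt y⟩ : ℕ) :=
    congrArg Fin.val h
  set A := (σ ⟨(x : ℕ) % n, fin_val_mod_lt x⟩ : ℕ)
  set B := (τ ⟨(x : ℕ) / n, fin_val_div_lt x⟩ : ℕ)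
  set C := (σ ⟨(y : ℕ) % n, fin_val_mod_lt y⟩ : ℕ)
  set D := (τ ⟨(y : ℕ) / n, fin_val_div_lt y⟩ : ℕ)
  have hB : B < m := (τ _).isLt
  have hD : D < m := (τ _).isLt
  have hBD : B = D := by
    have := congrArg (· % m) h'
    simpa [Nat.mul_add_mod, Nat.mod_eq_of_lt hB, Nat.mod_eq_of_lt hD] using this
  have hAC : A = C := by
    have hm : 0 < m := Nat.pos_of_ne_zero (by omega)
    have : m * A = m * C := by omega
    exact Nat.eq_of_mul_eq_mul_left hm this
  -- now deduce equality of σ/τ-arguments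
  have e1 : (⟨(x : ℕ) % n, fin_val_mod_lt x⟩ : Fin n) = ⟨(y : ℕ) % n, fin_val_mod_lt y⟩ :=
    σ.injective (Fin.val_injective hAC)
  have e2 : (⟨(x : ℕ) / n, fin_val_div_lt x⟩ : Fin m) = ⟨(y : ℕ) / n, fin_val_div_lt y⟩ :=
    τ.injective (Fin.val_injective hBD)
  have e1' : (x : ℕ) % n = (y : ℕ) % n := congrArg Fin.val e1
  have e2' : (x : ℕ) / n = (y : ℕ) / n := congrArg Fin.val e2
  have hx : n * ((x : ℕ) / n) + (x : ℕ) % n = (x : ℕ) := Nat.div_add_mod _ _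
  have hy : n * ((y : ℕ) / n) + (y : ℕ) % n = (y : ℕ) := Nat.div_add_mod _ _
  apply Fin.val_injective
  rw [← hx, ← hy, e1', e2']

/-- The permutation `Φ(σ, τ) ∈ S_{nm}`. -/
noncomputable def PhiPerm {n m : ℕ} (σ : Equiv.Perm (Fin n)) (τ : Equiv.Perm (Fin m)) :
    Equiv.Perm (Fin (n * m)) :=
  Equiv.ofBijective (PhiFun σ τ) (phiFun_bijective σ τ)

/-- Multiplication `(n, σ) ∘ (m, τ) := (nm, Φ(σ, τ))` on pairs of a natural number `n` and a
permutation `σ ∈ S_n`. -/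
noncomputable def NatPermMul (a b : Σ n : ℕ, Equiv.Perm (Fin n)) : Σ n : ℕ, Equiv.Perm (Fin n) :=
  ⟨a.1 * b.1, PhiPerm a.2 b.2⟩

/-- The unit `(1, id₁)`. -/
def NatPermOne : Σ n : ℕ, Equiv.Perm (Fin n) := ⟨1, Equiv.refl (Fin 1)⟩

theorem natPerm_ext (a b : Σ n : ℕ, Equiv.Perm (Fin n)) (h : a.1 = b.1)
    (h2 : ∀ (x : ℕ) (hx : x < a.1) (hy : x < b.1), (a.2 ⟨x, hx⟩ : ℕ) = (b.2 ⟨x, hy⟩ : ℕ)) :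
    a = b := by
  obtain ⟨n, σ⟩ := a
  obtain ⟨m, τ⟩ := b
  obtain rfl : n = m := h
  congr 1
  ext x
  exact h2 x x.2 x.2

theorem perm_val_congr {n : ℕ} (σ : Equiv.Perm (Fin n)) {x y : ℕ} (hx : x < n) (hy : y < n)
    (h : x = y) : (σ ⟨x, hx⟩ : ℕ) = (σ ⟨y, hy⟩ : ℕ) := by
  subst h; rfl

/-- The set of pairs `(n, σ)` with `n ∈ ℕ` and `σ ∈ S_n`, equipped with the
multiplication `(n, σ) ∘ (m, τ) := (nm, Φ(σ, τ))` and unit `(1, id₁)`, is a monoid: the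
multiplication is associative and `(1, id₁)` is a two-sided identity. -/
theorem natPermMul_monoid :
    (∀ a b c : Σ n : ℕ, Equiv.Perm (Fin n),
      NatPermMul (NatPermMul a b) c = NatPermMul a (NatPermMul b c)) ∧
    (∀ a : Σ n : ℕ, Equiv.Perm (Fin n), NatPermMul NatPermOne a = a) ∧
    (∀ a : Σ n : ℕ, Equiv.Perm (Fin n), NatPermMul a NatPermOne = a) := by
  refine ⟨?_, ?_, ?_⟩
  · rintro ⟨n, σ⟩ ⟨m, τ⟩ ⟨l, υ⟩
    refine natPerm_ext _ _ (Nat.mul_assoc n m l) ?_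
    intro x hx hy
    change x < n * m * l at hx
    change x < n * (m * l) at hy
    have hn : 0 < n := Nat.pos_of_ne_zero (by rintro rfl; simp at hx)
    have hm : 0 < m := Nat.pos_of_ne_zero (by rintro rfl; simp at hx)
    have b1 : x % n < n := Nat.mod_lt _ hn
    have b2 : x / n % m < m := Nat.mod_lt _ hm
    have b3 : x / n / m < l := by
      rw [Nat.div_div_eq_div_mul]; exact Nat.div_lt_of_lt_mul hx
    have c1 : x % (n * m) % n < n := Nat.mod_lt _ hn
    have c2 : x % (n * m) / n < m := Nat.div_lt_of_lt_mul (Nat.mod_lt _ (Nat.mul_pos hn hm))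
    have c3 : x / (n * m) < l := Nat.div_lt_of_lt_mul hx
    change l * (m * (σ ⟨x % (n * m) % n, c1⟩ : ℕ) + (τ ⟨x % (n * m) / n, c2⟩ : ℕ)) +
        (υ ⟨x / (n * m), c3⟩ : ℕ) =
      m * l * (σ ⟨x % n, b1⟩ : ℕ) + (l * (τ ⟨x / n % m, b2⟩ : ℕ) + (υ ⟨x / n / m, b3⟩ : ℕ))
    rw [perm_val_congr σ c1 b1 (Nat.mod_mul_right_mod x n m),
      perm_val_congr τ c2 b2 (Nat.mod_mul_right_div_self x n m),
      perm_val_congr υ c3 b3 (Nat.div_div_eq_div_mul x n m).symm]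
    ring
  · rintro ⟨n, σ⟩
    refine natPerm_ext _ _ (Nat.one_mul n) ?_
    intro x hx hy
    change x < n at hy
    have c2 : x / 1 < n := by simpa using hy
    change n * (x % 1) + (σ ⟨x / 1, c2⟩ : ℕ) = (σ ⟨x, hy⟩ : ℕ)
    rw [perm_val_congr σ c2 hy (Nat.div_one x), Nat.mod_one]
    simp
  · rintro ⟨n, σ⟩
    refine natPerm_ext _ _ (Nat.mul_one n) ?_
    intro x hx hy
    change x < n at hy
    have c1 : x % n < n := by rwa [Nat.mod_eq_of_lt hy]
    change 1 * (σ ⟨x % n, c1⟩ : ℕ) + x / n = (σ ⟨x, hy⟩ : ℕ)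
    rw [perm_val_congr σ c1 hy (Nat.mod_eq_of_lt hy), Nat.div_eq_of_lt hy]
    simp
end

section
/- Let A be a commutative algebra over a commutative ring k, and for a map f : {1,…,n} → {1,…,m} let f_* : A^{⊗n} → A^{⊗m} be the linear map determined by f_*(a_1 ⊗ ⋯ ⊗ a_n) = b_1 ⊗ ⋯ ⊗ b_m with b_j = ∏_{i ∈ f⁻¹(j)} a_i (empty products being 1). Then this assignment is functorial: (id)_* is the identity of A^{⊗n}, and for any maps f : {1,…,n} → {1,…,m} and g : {1,…,m} → {1,…,l} one has (g ∘ f)_* = g_* ∘ f_*. -/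
open scoped TensorProduct
open PiTensorProduct

/-- Let `A` be a commutative algebra over a commutative ring `k`, and for a
map `f : {1,…,n} → {1,…,m}` let `f_* : A^{⊗n} → A^{⊗m}` be the linear map determined by
`f_*(a_1 ⊗ ⋯ ⊗ a_n) = b_1 ⊗ ⋯ ⊗ b_m` with `b_j = ∏_{i ∈ f⁻¹(j)} a_i` (empty products being
`1`).  Then this assignment is functorial: `(id)_*` is the identity of `A^{⊗n}`, and for any
`f : {1,…,n} → {1,…,m}`, `g : {1,…,m} → {1,…,l}` one has `(g ∘ f)_* = g_* ∘ f_*`.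

Here the family of linear maps `F` is hypothesized together with its defining property on
elementary tensors, which determines each `F f` uniquely. -/
theorem fStar_functorial (k A : Type*) [CommRing k] [CommRing A] [Algebra k A]
    (F : ∀ {n m : ℕ}, (Fin n → Fin m) → ((⨂[k]^n A) →ₗ[k] ⨂[k]^m A))
    (hF : ∀ {n m : ℕ} (f : Fin n → Fin m) (a : Fin n → A),
      F f (tprod k a) =
        tprod k (fun j => ∏ i ∈ Finset.univ.filter (fun i => f i = j), a i)) :
    (∀ n : ℕ, F (id : Fin n → Fin n) = LinearMap.id) ∧
    (∀ (n m l : ℕ) (f : Fin n → Fin m) (g : Fin m → Fin l),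
      F (g ∘ f) = (F g).comp (F f)) := by
  constructor
  · intro n
    refine PiTensorProduct.ext (MultilinearMap.ext fun a => ?_)
    simp only [LinearMap.compMultilinearMap_apply, LinearMap.id_apply]
    refine (hF _ a).trans ?_
    congr 1
    funext j
    simp [Finset.filter_eq']
  · intro n m l f g
    refine PiTensorProduct.ext (MultilinearMap.ext fun a => ?_)
    simp only [LinearMap.compMultilinearMap_apply, LinearMap.comp_apply]
    refine (hF _ a).trans ?_
    refine Eq.trans ?_ ((congrArg (F g) (hF f a)).trans (hF g _)).symm
    congr 1
    funext c
    rw [← Finset.prod_fiberwise_of_maps_to (s := Finset.univ.filter (fun i => (g ∘ f) i = c))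
      (t := Finset.univ.filter (fun j => g j = c)) (g := f) (by simp)]
    refine Finset.prod_congr rfl fun j hj => ?_
    refine Finset.prod_congr ?_ fun _ _ => rfl
    ext i
    simp only [Finset.mem_filter, Finset.mem_univ, true_and, Function.comp_apply] at hj ⊢
    constructor
    · exact fun h => h.2
    · rintro rfl
      exact ⟨hj, rfl⟩
end

section
/- For every k ≥ 1 there exists a group homomorphism ξ_k : S_{k+1} → Aut(F_k) from the symmetric group on k+1 letters to the automorphism group of the free group F_k on generators x_1, …, x_k, such that for each 1 ≤ i ≤ k the adjacent transposition σ_i = (i, i+1) is sent to the automorphism determined by: x_{i−1} ↦ x_{i−1} x_i (when i > 1), x_i ↦ x_i⁻¹, x_{i+1} ↦ x_i x_{i+1} (when i < k), and x_j ↦ x_j for all other j. In particular each of these assignments on generators defines an automorphism of F_k. -/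
/-- The partial products `y_j = x_1 ⋯ x_j`, so that `x_j = y_{j-1}⁻¹ y_j`. -/
def xiY (k : ℕ) (j : Fin (k + 1)) : FreeGroup (Fin k) :=
  Fin.induction (motive := fun _ => FreeGroup (Fin k)) 1 (fun i p => p * FreeGroup.of i) j

theorem xiY_zero (k : ℕ) : xiY k 0 = 1 := rfl

theorem xiY_succ (k : ℕ) (i : Fin k) : xiY k i.succ = xiY k i.castSucc * FreeGroup.of i := by
  simp [xiY, Fin.induction_succ]

/-- The endomorphism attached to a permutation: `y_i⁻¹ y_j ↦ y_{π i}⁻¹ y_{π j}`. -/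
def xiEnd (k : ℕ) (p : Equiv.Perm (Fin (k + 1))) : FreeGroup (Fin k) →* FreeGroup (Fin k) :=
  FreeGroup.lift fun a => (xiY k (p a.castSucc))⁻¹ * xiY k (p a.succ)

theorem xiEnd_of (k : ℕ) (p : Equiv.Perm (Fin (k + 1))) (a : Fin k) :
    xiEnd k p (FreeGroup.of a) = (xiY k (p a.castSucc))⁻¹ * xiY k (p a.succ) := by
  simp [xiEnd]

theorem xiEnd_y (k : ℕ) (p : Equiv.Perm (Fin (k + 1))) (j : Fin (k + 1)) :
    xiEnd k p (xiY k j) = (xiY k (p 0))⁻¹ * xiY k (p j) := by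
  induction j using Fin.induction with
  | zero => simp [xiY_zero]
  | succ i ih => rw [xiY_succ, map_mul, ih, xiEnd_of]; group

theorem xiEnd_mul (k : ℕ) (p q : Equiv.Perm (Fin (k + 1))) :
    xiEnd k (p * q) = (xiEnd k p).comp (xiEnd k q) := by
  ext a
  simp only [MonoidHom.comp_apply, xiEnd_of, map_mul, map_inv, xiEnd_y, Equiv.Perm.mul_apply]
  group

theorem xiEnd_one (k : ℕ) : xiEnd k 1 = MonoidHom.id _ := by
  ext a
  simp [xiEnd_of, xiY_succ]

/-- The homomorphism `ξ_k`. -/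
def xiHom (k : ℕ) : Equiv.Perm (Fin (k + 1)) →* MulAut (FreeGroup (Fin k)) where
  toFun p := MonoidHom.toMulEquiv (xiEnd k p) (xiEnd k p⁻¹)
    (by rw [← xiEnd_mul, inv_mul_cancel, xiEnd_one])
    (by rw [← xiEnd_mul, mul_inv_cancel, xiEnd_one])
  map_one' := by
    ext x
    exact DFunLike.congr_fun (xiEnd_one k) x
  map_mul' p q := by
    ext x
    exact DFunLike.congr_fun (xiEnd_mul k p q) x


/-- For every `k ≥ 1` there exists a group homomorphism
`ξ_k : S_{k+1} → Aut(F_k)` from the symmetric group on `k+1` letters to the automorphism group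
of the free group `F_k` on generators `x_1, …, x_k`, such that for each `1 ≤ i ≤ k` the
adjacent transposition `σ_i = (i, i+1)` is sent to the automorphism determined by
`x_{i−1} ↦ x_{i−1} x_i` (when `i > 1`), `x_i ↦ x_i⁻¹`, `x_{i+1} ↦ x_i x_{i+1}` (when `i < k`),
and `x_j ↦ x_j` for all other `j`.  In particular each of these assignments on generators
defines an automorphism of `F_k`.

Indexing: the generator `x_{a+1}` corresponds to `a : Fin k`, and for `i : Fin k` the adjacent
transposition `σ_{i+1}` exchanging the letters `i+1` and `i+2` of `{1, …, k+1}` corresponds to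
`Equiv.swap i.castSucc i.succ ∈ Equiv.Perm (Fin (k+1))`. -/
theorem xi_hom_exists (k : ℕ) (hk : 1 ≤ k) :
    ∃ ξ : Equiv.Perm (Fin (k + 1)) →* MulAut (FreeGroup (Fin k)),
      ∀ i a : Fin k,
        ξ (Equiv.swap i.castSucc i.succ) (FreeGroup.of a) =
          if (a : ℕ) + 1 = (i : ℕ) then FreeGroup.of a * FreeGroup.of i
          else if (a : ℕ) = (i : ℕ) then (FreeGroup.of a)⁻¹
          else if (a : ℕ) = (i : ℕ) + 1 then FreeGroup.of i * FreeGroup.of a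
          else FreeGroup.of a := by
  refine ⟨xiHom k, fun i a => ?_⟩
  have e : xiHom k (Equiv.swap i.castSucc i.succ) (FreeGroup.of a) =
      (xiY k (Equiv.swap i.castSucc i.succ a.castSucc))⁻¹
        * xiY k (Equiv.swap i.castSucc i.succ a.succ) := xiEnd_of _ _ _
  rw [e]
  split_ifs with h1 h2 h3
  · have h4 : a.succ = i.castSucc := by ext; simpa using h1
    rw [Equiv.swap_apply_of_ne_of_ne (x := a.castSucc)
      (by simp [Fin.ext_iff]; omega) (by simp [Fin.ext_iff]; omega), h4, Equiv.swap_apply_left,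
      xiY_succ, ← h4, xiY_succ]
    group
  · obtain rfl : a = i := Fin.ext h2
    rw [Equiv.swap_apply_left, Equiv.swap_apply_right, xiY_succ]
    group
  · have h4 : a.castSucc = i.succ := by ext; simpa using h3
    rw [Equiv.swap_apply_of_ne_of_ne (x := a.succ)
      (by simp [Fin.ext_iff]; omega) (by simp [Fin.ext_iff]; omega), h4, Equiv.swap_apply_right,
      xiY_succ, h4, xiY_succ]
    group
  · rw [Equiv.swap_apply_of_ne_of_ne (x := a.succ)
      (by simp [Fin.ext_iff]; omega) (by simp [Fin.ext_iff]; omega),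
      Equiv.swap_apply_of_ne_of_ne (x := a.castSucc)
      (by simp [Fin.ext_iff]; omega) (by simp [Fin.ext_iff]; omega), xiY_succ]
    group
end

section
/- Let X be a finite set with k+1 elements, and let ξ(X) be the group generated by symbols ⟨x,y⟩ for x, y ∈ X, subject to the relations ⟨x,y⟩·⟨y,z⟩ = ⟨x,z⟩ for all x, y, z ∈ X. Then ξ(X) is isomorphic to the free group on k generators. -/
/-- The relations `⟨x,y⟩·⟨y,z⟩ = ⟨x,z⟩` (as elements `⟨x,y⟩⟨y,z⟩⟨x,z⟩⁻¹` of the free group on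
the generating set `X × X`, where `⟨x,y⟩` is the generator corresponding to `(x, y)`). -/
def xiRels (X : Type*) : Set (FreeGroup (X × X)) :=
  { r | ∃ x y z : X,
      r = FreeGroup.of (x, y) * FreeGroup.of (y, z) * (FreeGroup.of (x, z))⁻¹ }

/-- Let `X` be a finite set with `k+1` elements and let `ξ(X)` be the group
generated by symbols `⟨x,y⟩`, `x, y ∈ X`, subject to the relations `⟨x,y⟩·⟨y,z⟩ = ⟨x,z⟩` for
all `x, y, z ∈ X`.  Then `ξ(X)` is isomorphic to the free group on `k` generators. -/
theorem presentedGroup_xiRels_iso_freeGroup (k : ℕ) (X : Type*) [Fintype X]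
    (hX : Fintype.card X = k + 1) :
    Nonempty (PresentedGroup (xiRels X) ≃* FreeGroup (Fin k)) := by
  classical
  let e : X ≃ Fin (k + 1) := Fintype.equivFinOfCardEq hX
  let g : X → FreeGroup (Fin k) := fun x => Fin.cases 1 FreeGroup.of (e x)
  let p : X → X → PresentedGroup (xiRels X) := fun x y => PresentedGroup.of (x, y)
  have hp : ∀ x y z, p x y * p y z = p x z := by
    intro x y z
    have h : PresentedGroup.mk (xiRels X)
        (FreeGroup.of (x, y) * FreeGroup.of (y, z) * (FreeGroup.of (x, z))⁻¹) = 1 :=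
      PresentedGroup.one_of_mem ⟨x, y, z, rfl⟩
    rw [map_mul, map_mul, map_inv, mul_inv_eq_one] at h
    exact h
  have hp1 : ∀ x, p x x = 1 := fun x => by simpa using hp x x x
  have hg0 : g (e.symm 0) = 1 := by simp [g]
  have hgs : ∀ i : Fin k, g (e.symm i.succ) = FreeGroup.of i := by
    intro i
    simp [g]
  have hrel : ∀ r ∈ xiRels X,
      FreeGroup.lift (fun q : X × X => (g q.1)⁻¹ * g q.2) r = 1 := by
    rintro r ⟨x, y, z, rfl⟩
    simp only [map_mul, map_inv, FreeGroup.lift_apply_of]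
    group
  let F : PresentedGroup (xiRels X) →* FreeGroup (Fin k) := PresentedGroup.toGroup hrel
  have hF : ∀ x y, F (p x y) = (g x)⁻¹ * g y := fun x y => PresentedGroup.toGroup.of hrel
  let G : FreeGroup (Fin k) →* PresentedGroup (xiRels X) :=
    FreeGroup.lift (fun i => p (e.symm 0) (e.symm i.succ))
  have hG : ∀ x, G (g x) = p (e.symm 0) x := by
    intro x
    obtain ⟨j, rfl⟩ := e.symm.surjective x
    induction j using Fin.cases with
    | zero => rw [hg0, map_one, hp1]
    | succ i => rw [hgs]; exact FreeGroup.lift_apply_of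
  refine ⟨MonoidHom.toMulEquiv F G ?_ ?_⟩
  · refine PresentedGroup.ext ?_
    rintro ⟨x, y⟩
    change G (F (p x y)) = p x y
    rw [hF, map_mul, map_inv, hG, hG, inv_mul_eq_iff_eq_mul, hp]
  · refine FreeGroup.ext_hom _ _ ?_
    intro i
    change F (G (FreeGroup.of i)) = FreeGroup.of i
    rw [← hgs i, hG, hF, hg0, inv_one, one_mul]
end
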